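/- Let A be a nonempty finite set and τ > 0. The softmax map is (1/τ)-Lipschitz with respect to the Euclidean norm: for all x, y : A → ℝ, ‖softmax_τ(x) − softmax_τ(y)‖₂ ≤ (1/τ)·‖x − y‖₂, where softmax_τ(x)(a) = exp(x(a)/τ)/Σ_{b∈A} exp(x(b)/τ). -/

import Mathlib

/-- On `(0, 1]` the logarithm grows at least as fast as the identity. -/
theorem sub_le_log_sub_log {p q : ℝ} (hq : 0 < q) (hqp : q ≤ p) (hp : p ≤ 1) :
    p - q ≤ Real.log p - Real.log q := by
  have hp0 : 0 < p := hq.trans_le hqp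
  have hlog := Real.log_le_sub_one_of_pos (div_pos hq hp0)
  rw [Real.log_div hq.ne' hp0.ne'] at hlog
  have hdiv : p - q ≤ (p - q) / p := le_div_self (sub_nonneg.2 hqp) hp0 hp
  rw [sub_div, div_self hp0.ne'] at hdiv
  linarith

/-- The logarithm is strongly monotone on `(0, 1]`. -/
theorem sq_sub_le_mul_log_sub_log {p q : ℝ} (hp : 0 < p) (hq : 0 < q) (hp1 : p ≤ 1)
    (hq1 : q ≤ 1) : (p - q) ^ 2 ≤ (p - q) * (Real.log p - Real.log q) := by
  rcases le_total q p with h | h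
  · nlinarith [sub_le_log_sub_log hq h hp1]
  · nlinarith [sub_le_log_sub_log hp h hq1]

theorem softmax_mem_Ioc {A : Type*} [Fintype A] (u : A → ℝ) (a : A) :
    Real.exp (u a) / ∑ b, Real.exp (u b) ∈ Set.Ioc (0 : ℝ) 1 := by
  have hle : Real.exp (u a) ≤ ∑ b, Real.exp (u b) :=
    Finset.single_le_sum (f := fun b => Real.exp (u b)) (fun b _ => (Real.exp_pos _).le)
      (Finset.mem_univ a)
  have hpos := (Real.exp_pos (u a)).trans_le hle
  exact ⟨div_pos (Real.exp_pos _) hpos, (div_le_one hpos).2 hle⟩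

theorem sum_softmax {A : Type*} [Fintype A] [Nonempty A] (u : A → ℝ) :
    ∑ a, Real.exp (u a) / ∑ b, Real.exp (u b) = 1 := by
  rw [← Finset.sum_div]
  exact div_self (Finset.sum_pos (fun b _ => Real.exp_pos _) Finset.univ_nonempty).ne'

theorem log_softmax {A : Type*} [Fintype A] [Nonempty A] (u : A → ℝ) (a : A) :
    Real.log (Real.exp (u a) / ∑ b, Real.exp (u b)) =
      u a - Real.log (∑ b, Real.exp (u b)) := by
  rw [Real.log_div (Real.exp_pos _).ne'
    (Finset.sum_pos (fun b _ => Real.exp_pos _) Finset.univ_nonempty).ne', Real.log_exp]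

/-- The softmax map is cocoercive for the Euclidean inner product. -/
theorem sum_sq_softmax_sub_le_inner {A : Type*} [Fintype A] [Nonempty A] (u v : A → ℝ) :
    ∑ a, (Real.exp (u a) / ∑ b, Real.exp (u b) - Real.exp (v a) / ∑ b, Real.exp (v b)) ^ 2 ≤
      ∑ a, (Real.exp (u a) / ∑ b, Real.exp (u b) - Real.exp (v a) / ∑ b, Real.exp (v b)) *
        (u a - v a) := by
  set c := Real.log (∑ b, Real.exp (u b)) - Real.log (∑ b, Real.exp (v b))
  have hzero : ∑ a, (Real.exp (u a) / ∑ b, Real.exp (u b) -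
      Real.exp (v a) / ∑ b, Real.exp (v b)) * c = 0 := by
    rw [← Finset.sum_mul, Finset.sum_sub_distrib, sum_softmax, sum_softmax, sub_self, zero_mul]
  rw [← sub_zero (∑ a, _ * (u a - v a)), ← hzero, ← Finset.sum_sub_distrib]
  refine Finset.sum_le_sum fun a _ => ?_
  obtain ⟨hp, hp1⟩ := softmax_mem_Ioc u a
  obtain ⟨hq, hq1⟩ := softmax_mem_Ioc v a
  refine (sq_sub_le_mul_log_sub_log hp hq hp1 hq1).trans_eq ?_
  rw [log_softmax, log_softmax]
  ring

theorem sum_sq_softmax_sub_le {A : Type*} [Fintype A] [Nonempty A] (u v : A → ℝ) :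
    ∑ a, (Real.exp (u a) / ∑ b, Real.exp (u b) - Real.exp (v a) / ∑ b, Real.exp (v b)) ^ 2 ≤
      ∑ a, (u a - v a) ^ 2 := by
  have hinner := sum_sq_softmax_sub_le_inner u v
  have hyoung := Finset.sum_le_sum fun a (_ : a ∈ Finset.univ) => two_mul_le_add_sq
    (Real.exp (u a) / ∑ b, Real.exp (u b) - Real.exp (v a) / ∑ b, Real.exp (v b)) (u a - v a)
  simp only [mul_assoc, ← Finset.mul_sum, Finset.sum_add_distrib] at hyoung
  linarith

theorem stmt_11 {A : Type*} [Fintype A] [Nonempty A] (τ : ℝ) (hτ : 0 < τ)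
    (x y : A → ℝ) :
    Real.sqrt (∑ a, ((Real.exp (x a / τ) / ∑ b, Real.exp (x b / τ)) -
        (Real.exp (y a / τ) / ∑ b, Real.exp (y b / τ))) ^ 2) ≤
      (1 / τ) * Real.sqrt (∑ a, (x a - y a) ^ 2) := by
  refine (Real.sqrt_le_sqrt
    (sum_sq_softmax_sub_le (fun a => x a / τ) (fun a => y a / τ))).trans_eq ?_
  simp only [← sub_div, div_pow, ← Finset.sum_div]
  rw [Real.sqrt_div' _ (sq_nonneg τ), Real.sqrt_sq hτ.le, one_div_mul_eq_div]
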